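/- Let m n : ℕ, let ω ∈ ℝ, and set s = i * ω (where i is the imaginary unit). Let x : ℝ → ℂ be m-times differentiable and y : ℝ → ℂ be n-times differentiable on [0, ∞) with iterated derivatives x^(k), y^(k), suppose for each k ≤ m (resp. k ≤ n) the Laplace transform of x^(k) (resp. y^(k)) exists at s and x^(k) (resp. y^(k)) is of exponential order (M_k, a_k) with Re s > a_k, suppose x^(k)(0) = 0 for k < m and y^(k)(0) = 0 for k < n, let α : Fin (n+1) → ℂ and β : Fin (m+1) → ℂ satisfy ∑_{k=0}^{n} α k * y^(k)(t) = ∑_{k=0}^{m} β k * x^(k)(t) for all t ≥ 0, and suppose L[x](i*ω) ≠ 0 and ∑_{k=0}^{n} α k * (i*ω)^k ≠ 0. Then the frequency response L[y](i*ω) / L[x](i*ω) equals (∑_{k=0}^{m} β k * (i*ω)^k) / (∑_{k=0}^{n} α k * (i*ω)^k) (frequency response of a generic n-th order linear system). -/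

import Mathlib

open MeasureTheory Set

/-- The Laplace transform of `f : ℝ → ℂ` at `s : ℂ`. -/
noncomputable def laplace (f : ℝ → ℂ) (s : ℂ) : ℂ :=
  ∫ t in Set.Ioi (0 : ℝ), Complex.exp (-(s * t)) * f t

/-- The Laplace transform of `f` exists at `s`. -/
def laplaceExists (f : ℝ → ℂ) (s : ℂ) : Prop :=
  MeasureTheory.IntegrableOn (fun t : ℝ => Complex.exp (-(s * t)) * f t) (Set.Ioi (0 : ℝ))

/-- `f` is of exponential order `(M, a)`. -/
def expOrder (f : ℝ → ℂ) (M a : ℝ) : Prop :=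
  0 < M ∧ ∀ t : ℝ, 0 ≤ t → ‖f t‖ ≤ M * Real.exp (a * t)

/-- A function of exponential order `(M, a)` damped by `exp (-(s * t))` tends to zero
when `a < s.re`. -/
theorem expOrder.tendsto_exp_mul {f : ℝ → ℂ} {M a : ℝ} {s : ℂ} (hf : expOrder f M a)
    (ha : a < s.re) :
    Filter.Tendsto (fun t : ℝ => Complex.exp (-(s * t)) * f t) Filter.atTop (nhds 0) := by
  have hlim : Filter.Tendsto (fun t : ℝ => M * Real.exp (-((s.re - a) * t)))
      Filter.atTop (nhds 0) := by
    have h := (Real.tendsto_exp_neg_atTop_nhds_zero.comp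
      (Filter.tendsto_id.const_mul_atTop (sub_pos.2 ha))).const_mul M
    simpa [Function.comp_def] using h
  refine squeeze_zero_norm' ?_ hlim
  filter_upwards [Filter.eventually_ge_atTop (0 : ℝ)] with t ht
  calc ‖Complex.exp (-(s * t)) * f t‖ = Real.exp (-(s.re * t)) * ‖f t‖ := by
        rw [norm_mul, Complex.norm_exp]; simp
    _ ≤ Real.exp (-(s.re * t)) * (M * Real.exp (a * t)) := by
        gcongr
        exact hf.2 t ht
    _ = M * Real.exp (-((s.re - a) * t)) := by
        rw [mul_left_comm, ← Real.exp_add]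
        ring_nf

/-- The Laplace transform of a derivative. -/
theorem laplace_deriv {f : ℝ → ℂ} {M a : ℝ} {s : ℂ}
    (hdiff : ∀ t ∈ Set.Ici (0 : ℝ), DifferentiableAt ℝ f t)
    (hf : expOrder f M a) (ha : a < s.re)
    (hlap : laplaceExists f s) (hlap' : laplaceExists (deriv f) s) :
    laplace (deriv f) s = s * laplace f s - f 0 := by
  have hderiv : ∀ t ∈ Set.Ici (0 : ℝ),
      HasDerivAt (fun t : ℝ => Complex.exp (-(s * t)) * f t)
        (Complex.exp (-(s * t)) * deriv f t - s * (Complex.exp (-(s * t)) * f t)) t := by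
    intro t ht
    have hexp : HasDerivAt (fun t : ℝ => Complex.exp (-(s * t)))
        (Complex.exp (-(s * t)) * -(s * 1)) t :=
      ((Complex.ofRealCLM.hasDerivAt (x := t)).const_mul s).neg.cexp
    convert! hexp.mul (hdiff t ht).hasDerivAt using 1
    ring
  have hsmul : IntegrableOn (fun t : ℝ => s * (Complex.exp (-(s * t)) * f t)) (Set.Ioi 0) :=
    Integrable.const_mul hlap s
  have h := integral_Ioi_of_hasDerivAt_of_tendsto' hderiv (Integrable.sub hlap' hsmul)
    (hf.tendsto_exp_mul ha)
  rw [integral_sub hlap' hsmul, integral_const_mul] at h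
  simp only [Complex.ofReal_zero, mul_zero, neg_zero, Complex.exp_zero, one_mul] at h
  unfold laplace
  linear_combination h

/-- The Laplace transform of an iterated derivative with vanishing initial values. -/
theorem laplace_iterate_deriv {f : ℝ → ℂ} {s : ℂ} {n : ℕ}
    (hdiff : ∀ k < n, ∀ t ∈ Set.Ici (0 : ℝ), DifferentiableAt ℝ (deriv^[k] f) t)
    (hexp : ∀ k ≤ n, ∃ M a : ℝ, a < s.re ∧ expOrder (deriv^[k] f) M a)
    (hlap : ∀ k ≤ n, laplaceExists (deriv^[k] f) s)
    (hzero : ∀ k < n, deriv^[k] f 0 = 0) :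
    ∀ k ≤ n, laplace (deriv^[k] f) s = s ^ k * laplace f s := by
  intro k
  induction k with
  | zero => simp
  | succ k ih =>
    intro hk
    obtain ⟨M, a, ha, hf⟩ := hexp k (by omega)
    have hlap' := hlap (k + 1) hk
    rw [Function.iterate_succ_apply'] at hlap' ⊢
    rw [laplace_deriv (hdiff k hk) hf ha (hlap k (by omega)) hlap', hzero k hk, ih (by omega)]
    ring

/-- The Laplace transform of a finite linear combination. -/
theorem laplace_sum {ι : Type*} [Fintype ι] (c : ι → ℂ) (f : ι → ℝ → ℂ) {s : ℂ}
    (hlap : ∀ i, laplaceExists (f i) s) :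
    laplace (fun t => ∑ i, c i * f i t) s = ∑ i, c i * laplace (f i) s := by
  unfold laplace
  simp_rw [← integral_const_mul]
  rw [← integral_finsetSum _ fun i _ => Integrable.const_mul (hlap i) (c i)]
  congr 1 with t
  rw [Finset.mul_sum]
  exact Finset.sum_congr rfl fun i _ => by ring

/-- Frequency response of a generic n-th order linear system. -/
theorem frequency_response_n_order_system (m n : ℕ) (x y : ℝ → ℂ) (ω : ℝ)
    (α : Fin (n + 1) → ℂ) (β : Fin (m + 1) → ℂ)
    (hxdiff : ∀ k < m, ∀ t ∈ Set.Ici (0 : ℝ), DifferentiableAt ℝ (deriv^[k] x) t)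
    (hydiff : ∀ k < n, ∀ t ∈ Set.Ici (0 : ℝ), DifferentiableAt ℝ (deriv^[k] y) t)
    (hxexp : ∀ k ≤ m, ∃ M a : ℝ, a < (Complex.I * ω).re ∧ expOrder (deriv^[k] x) M a)
    (hyexp : ∀ k ≤ n, ∃ M a : ℝ, a < (Complex.I * ω).re ∧ expOrder (deriv^[k] y) M a)
    (hxlap : ∀ k ≤ m, laplaceExists (deriv^[k] x) (Complex.I * ω))
    (hylap : ∀ k ≤ n, laplaceExists (deriv^[k] y) (Complex.I * ω))
    (hxzero : ∀ k < m, deriv^[k] x 0 = 0)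
    (hyzero : ∀ k < n, deriv^[k] y 0 = 0)
    (hdiffeq : ∀ t : ℝ, 0 ≤ t →
      ∑ k : Fin (n + 1), α k * deriv^[(k : ℕ)] y t =
        ∑ k : Fin (m + 1), β k * deriv^[(k : ℕ)] x t)
    (hx0 : laplace x (Complex.I * ω) ≠ 0)
    (hden : ∑ k : Fin (n + 1), α k * (Complex.I * ω) ^ (k : ℕ) ≠ 0) :
    laplace y (Complex.I * ω) / laplace x (Complex.I * ω) =
      (∑ k : Fin (m + 1), β k * (Complex.I * ω) ^ (k : ℕ)) /
        (∑ k : Fin (n + 1), α k * (Complex.I * ω) ^ (k : ℕ)) := by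
  have hlx := laplace_iterate_deriv hxdiff hxexp hxlap hxzero
  have hly := laplace_iterate_deriv hydiff hyexp hylap hyzero
  have hlaplace : laplace (fun t => ∑ k : Fin (n + 1), α k * deriv^[(k : ℕ)] y t)
      (Complex.I * ω) =
      laplace (fun t => ∑ k : Fin (m + 1), β k * deriv^[(k : ℕ)] x t) (Complex.I * ω) :=
    setIntegral_congr_fun measurableSet_Ioi fun t ht => by
      simp only [hdiffeq t (le_of_lt ht)]
  rw [laplace_sum α (fun k => deriv^[(k : ℕ)] y) fun k => hylap k (by omega),
    laplace_sum β (fun k => deriv^[(k : ℕ)] x) fun k => hxlap k (by omega),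
    Finset.sum_congr rfl fun k _ => congrArg (α k * ·) (hly k (by omega)),
    Finset.sum_congr rfl fun k _ => congrArg (β k * ·) (hlx k (by omega))] at hlaplace
  simp only [← mul_assoc, ← Finset.sum_mul] at hlaplace
  rw [div_eq_div_iff hx0 hden, mul_comm, hlaplace]
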